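/- Let k be a perfect field, let S = k[x_0, ..., x_{N-1}] be a standard graded polynomial ring in N ≥ 3 variables with homogeneous maximal ideal 𝔪 = (x_0, ..., x_{N-1}), and let I be a radical homogeneous ideal of S of height N-1 that is minimally generated by C(N,2) quadrics (forms of degree 2), where C(N,2) is the binomial coefficient. Then for every positive integer m, the annihilator ann_S(I^(m)/I^m) equals 𝔪^⌊m(N-2)/(N-1)⌋. -/

import Mathlib

open Ideal Filter

universe u

/-- The `m`-th symbolic power of an ideal `I`: the intersection, over all associated primes `p`
of `S ⧸ I`, of the contractions of `I ^ m` extended to the localization at `p`. -/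
noncomputable def symbolicPower {S : Type*} [CommRing S] (I : Ideal S) (m : ℕ) : Ideal S :=
  ⨅ p : associatedPrimes S (S ⧸ I),
    letI : p.1.IsPrime := p.2.isPrime
    ((I ^ m).map (algebraMap S (Localization.AtPrime p.1))).comap
      (algebraMap S (Localization.AtPrime p.1))

/-- The height of an ideal: the infimum of the heights of the primes containing it. -/
noncomputable def idealHeight {S : Type*} [CommRing S] (I : Ideal S) : ℕ∞ :=
  ⨅ (p : PrimeSpectrum S) (_ : I ≤ p.asIdeal), Order.height p

open scoped TensorProduct in
theorem isReduced_tensorProduct_of_finite_of_isSeparable (k L A : Type*) [Field k] [Field L]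
    [Algebra k L] [FiniteDimensional k L] [Algebra.IsSeparable k L] [CommRing A] [Algebra k A]
    [IsReduced A] : IsReduced (A ⊗[k] L) := by
  classical
  let b := Module.finBasis k L
  let bA := Algebra.TensorProduct.basis A b
  let d := (Algebra.traceForm k L).dualBasis (traceForm_nondegenerate k L) b
  have htrace (a : A) (l : L) :
      Algebra.trace A (A ⊗[k] L) (a ⊗ₜ l) = a * algebraMap k A (Algebra.trace k L l) := by
    have h : a ⊗ₜ[k] l = a • (1 ⊗ₜ[k] l : A ⊗[k] L) := by simp [TensorProduct.smul_tmul']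
    rw [h, map_smul, Algebra.trace_apply, ← Algebra.baseChange_lmul, LinearMap.trace_baseChange,
      Algebra.trace_apply, smul_eq_mul]
  have hrepr (i) (x : A ⊗[k] L) :
      bA.repr x i = Algebra.trace A (A ⊗[k] L) (x * 1 ⊗ₜ d i) := by
    induction x using TensorProduct.induction_on with
    | zero => simp
    | add x y hx hy => simp only [map_add, Finsupp.add_apply, add_mul, hx, hy]
    | tmul a l =>
      have h : Algebra.trace k L (l * d i) = b.repr l i := by
        conv_lhs => rw [← b.sum_repr l, Finset.sum_mul, map_sum]
        have h' (j) : Algebra.trace k L (b j * d i) = if j = i then 1 else 0 := by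
          rw [mul_comm]
          exact LinearMap.BilinForm.apply_dualBasis_left (traceForm_nondegenerate k L) b i j
        simp [h']
      simp [bA, htrace, h]
  refine ⟨fun x hx ↦ bA.ext_elem fun i ↦ ?_⟩
  rw [hrepr, map_zero, Finsupp.zero_apply]
  refine IsNilpotent.eq_zero ?_
  rw [Algebra.trace_apply]
  exact LinearMap.isNilpotent_trace_of_isNilpotent
    (((Commute.all x _).isNilpotent_mul_right hx).map (Algebra.lmul A (A ⊗[k] L)))

open scoped TensorProduct in
theorem isReduced_tensorProduct_of_isSeparable (k K A : Type*) [Field k] [Field K]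
    [Algebra k K] [Algebra.IsSeparable k K] [CommRing A] [Algebra k A] [IsReduced A] :
    IsReduced (A ⊗[k] K) := by
  refine IsReduced.tensorProduct_of_flat_of_forall_fg fun B ⟨s, hs⟩ ↦ ?_
  have hF := IntermediateField.adjoin_toSubalgebra_of_isAlgebraic (F := k) (E := K) (S := s)
    fun x _ ↦ Algebra.IsAlgebraic.isAlgebraic x
  let F := IntermediateField.adjoin k (s : Set K)
  have : FiniteDimensional k F := IntermediateField.finiteDimensional_adjoin
    fun x _ ↦ Algebra.IsIntegral.isIntegral x
  rw [hs] at hF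
  rw [← hF]
  exact isReduced_tensorProduct_of_finite_of_isSeparable k F A

open scoped TensorProduct in
theorem MvPolynomial.isRadical_map_of_isAlgebraic {k K σ : Type*} [Field k] [PerfectField k]
    [Field K] [Algebra k K] [Algebra.IsAlgebraic k K] {I : Ideal (MvPolynomial σ k)}
    (hI : I.IsRadical) : (I.map (MvPolynomial.map (algebraMap k K))).IsRadical := by
  have : IsReduced (MvPolynomial σ k ⧸ I) := (Ideal.isRadical_iff_quotient_reduced I).mp hI
  have := isReduced_tensorProduct_of_isSeparable k K (MvPolynomial σ k ⧸ I)
  have : IsReduced (K ⊗[k] (MvPolynomial σ k ⧸ I)) :=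
    isReduced_of_injective (Algebra.TensorProduct.comm k K (MvPolynomial σ k ⧸ I))
      (AlgEquiv.injective _)
  have hker := Algebra.TensorProduct.lTensor_ker (A := K) (Ideal.Quotient.mkₐ k I)
    (Ideal.Quotient.mkₐ_surjective k I)
  rw [show RingHom.ker (Ideal.Quotient.mkₐ k I) = I from Ideal.mk_ker] at hker
  let e := MvPolynomial.algebraTensorAlgEquiv (σ := σ) k K
  have hJ : I.map (MvPolynomial.map (algebraMap k K)) = (I.map
      (Algebra.TensorProduct.includeRight : MvPolynomial σ k →ₐ[k] K ⊗[k] MvPolynomial σ k)).comap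
        e.symm := by
    have h := Ideal.map_comap_of_equiv (I := I.map (Algebra.TensorProduct.includeRight :
      MvPolynomial σ k →ₐ[k] K ⊗[k] MvPolynomial σ k)) e.toRingEquiv
    refine Eq.trans ?_ h
    change _ = Ideal.map (e : K ⊗[k] MvPolynomial σ k →+* MvPolynomial σ K)
      (Ideal.map (Algebra.TensorProduct.includeRight :
      MvPolynomial σ k →ₐ[k] K ⊗[k] MvPolynomial σ k).toRingHom I)
    rw [Ideal.map_map]
    congr 1
    ext <;> simp [e]
  rw [hJ, ← hker]
  refine ((RingHom.ker_isRadical_iff_reduced_of_surjective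
    (f := Algebra.TensorProduct.map (AlgHom.id k K) (Ideal.Quotient.mkₐ k I)) ?_).mpr
    inferInstance).comap _
  exact TensorProduct.map_surjective Function.surjective_id (Ideal.Quotient.mkₐ_surjective k I)

theorem exists_algEquiv_pi_of_isAlgClosed (K B : Type*) [Field K] [IsAlgClosed K] [CommRing B]
    [Algebra K B] [FiniteDimensional K B] [IsReduced B] {ι : Type*} [Fintype ι]
    (hι : Module.finrank K B = Fintype.card ι) : Nonempty (B ≃ₐ[K] (ι → K)) := by
  have : IsArtinianRing B := isArtinian_of_tower K inferInstance
  let _ (m : MaximalSpectrum B) : Field (B ⧸ m.asIdeal) := Ideal.Quotient.field m.asIdeal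
  have e : B ≃ₐ[K] (MaximalSpectrum B → K) :=
    ((IsArtinianRing.equivPi _).restrictScalars K).trans
      (AlgEquiv.piCongrRight fun _ ↦ (AlgEquiv.ofBijective (Algebra.ofId K _)
        IsAlgClosed.algebraMap_bijective_of_isIntegral).symm)
  have := Fintype.ofFinite (MaximalSpectrum B)
  have hcard : Fintype.card (MaximalSpectrum B) = Fintype.card ι := by
    rw [← hι, e.toLinearEquiv.finrank_eq, Module.finrank_fintype_fun_eq_card]
  exact ⟨e.trans (AlgEquiv.piCongrLeft K (fun _ ↦ K) (Fintype.equivOfCardEq hcard))⟩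

theorem exists_linearEquiv_mul_eq_zero {K R ι : Type*} [Field K] [IsAlgClosed K] [CommRing R]
    [IsReduced R] [Algebra K R] [Fintype ι] [DecidableEq ι] (β : (ι → K) →ₗ[K] R)
    (hβ : Function.Injective β) (w : ι → K) (hw : β w ∈ nonZeroDivisors R)
    (hmul : ∀ u v, ∃ z, β u * β v = β z * β w) :
    ∃ s : (ι → K) ≃ₗ[K] (ι → K), ∀ i j, i ≠ j →
      β (s.symm (Pi.single i 1)) * β (s.symm (Pi.single j 1)) = 0 := by
  let R' := FractionRing R
  have : IsReduced R' := isReduced_localizationPreserves (nonZeroDivisors R) R' inferInstance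
  have hinj : Function.Injective (algebraMap R R') := IsFractionRing.injective R R'
  obtain ⟨c, hc⟩ := (IsLocalization.map_units R' ⟨_, hw⟩ : IsUnit (algebraMap R R' (β w)))
  let γ : (ι → K) →ₗ[K] R' := (LinearMap.mulLeft K (↑c⁻¹ : R')) ∘ₗ
    ((IsScalarTower.toAlgHom K R R').toLinearMap ∘ₗ β)
  have hγ (u) : γ u = ↑c⁻¹ * algebraMap R R' (β u) := rfl
  have hγinj : Function.Injective γ := fun u v h ↦ by
    rw [hγ, hγ] at h
    exact hβ (hinj (c⁻¹.isUnit.mul_left_cancel h))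
  have hγw : γ w = 1 := by rw [hγ, ← hc, Units.inv_mul]
  have hγmul (u v) : ∃ z, γ u * γ v = γ z := by
    obtain ⟨z, hz⟩ := hmul u v
    refine ⟨z, ?_⟩
    have hz' := congrArg (algebraMap R R') hz
    rw [map_mul, map_mul, ← hc] at hz'
    simp only [hγ]
    calc _ = (↑c⁻¹ * ↑c⁻¹ : R') * (algebraMap R R' (β u) * algebraMap R R' (β v)) := by ring
      _ = ↑c⁻¹ * algebraMap R R' (β z) * (↑c⁻¹ * ↑c) := by rw [hz']; ring
      _ = _ := by rw [Units.inv_mul, mul_one]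
  let B : Subalgebra K R' := (LinearMap.range γ).toSubalgebra ⟨w, hγw⟩ (by
    rintro _ _ ⟨u, rfl⟩ ⟨v, rfl⟩
    obtain ⟨z, hz⟩ := hγmul u v
    exact ⟨z, hz.symm⟩)
  let eB : (ι → K) ≃ₗ[K] B := LinearEquiv.ofInjective γ hγinj
  have heB (u) : (eB u : R') = γ u := rfl
  have : FiniteDimensional K B := eB.finiteDimensional
  have : IsReduced B := isReduced_of_injective B.val Subtype.val_injective
  obtain ⟨e⟩ := exists_algEquiv_pi_of_isAlgClosed K B (ι := ι) (by
    rw [← eB.finrank_eq, Module.finrank_fintype_fun_eq_card])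
  refine ⟨eB.trans e.toLinearEquiv, fun i j hij ↦ ?_⟩
  set s := eB.trans e.toLinearEquiv
  have h (i) : γ (s.symm (Pi.single i 1)) = (e.symm (Pi.single i 1) : B) := by
    rw [← heB]
    simp [s]
  have h0 : γ (s.symm (Pi.single i 1)) * γ (s.symm (Pi.single j 1)) = 0 := by
    have hs : (Pi.single i 1 * Pi.single j 1 : ι → K) = 0 := by
      ext l
      by_cases hl : l = i <;> simp [hl, hij]
    rw [h, h, ← MulMemClass.coe_mul, ← map_mul, hs]
    simp
  rw [hγ, hγ, mul_mul_mul_comm, ← Units.val_mul, Units.mul_right_eq_zero, ← map_mul] at h0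
  exact (map_eq_zero_iff _ hinj).mp h0

namespace MvPolynomial

theorem span_range_le_idealOfVars_pow {σ R ι : Type*} [CommSemiring R]
    {g : ι → MvPolynomial σ R} {n : ℕ} (hg : ∀ i, (g i).IsHomogeneous n) :
    Ideal.span (Set.range g) ≤ idealOfVars σ R ^ n := by
  rw [Ideal.span_le]
  rintro _ ⟨i, rfl⟩
  rw [SetLike.mem_coe, mem_pow_idealOfVars_iff']
  exact fun x hx ↦ (hg i).coeff_eq_zero hx.ne

theorem not_idealOfVars_le_of_mem_associatedPrimes {σ k : Type*} [Finite σ] [Nonempty σ] [Field k]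
    {I : Ideal (MvPolynomial σ k)} (hI : I.IsRadical) (h2 : I ≤ idealOfVars σ k ^ 2)
    {p : Ideal (MvPolynomial σ k)}
    (hp : p ∈ associatedPrimes (MvPolynomial σ k) (MvPolynomial σ k ⧸ I)) :
    ¬ idealOfVars σ k ≤ p := by
  intro hle
  obtain ⟨hprime, x, hx⟩ := isAssociatedPrime_iff.mp hp
  obtain ⟨g, rfl⟩ := Ideal.Quotient.mk_surjective x
  have hmem (f) : f ∈ p ↔ f * g ∈ I := by
    rw [hx, Submodule.mem_colon_singleton, Submodule.mem_bot, ← Ideal.Quotient.eq_zero_iff_mem,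
      map_mul]
    rfl
  have hg : g ∉ I := fun h ↦ hprime.ne_top (by
    rw [Ideal.eq_top_iff_one, hmem, one_mul]
    exact h)
  by_cases hc : coeff 0 g = 0
  · have hgv : g ∈ idealOfVars σ k := by
      rw [← pow_one (idealOfVars σ k), mem_pow_idealOfVars_iff']
      intro d hd
      rw [(Finsupp.degree_eq_zero_iff d).mp (by omega), hc]
    exact hg (hI ⟨2, by rw [pow_two]; exact (hmem g).mp (hle hgv)⟩)
  · obtain ⟨i⟩ := ‹Nonempty σ›
    have h1 := h2 ((hmem _).mp (hle (Ideal.subset_span ⟨i, rfl⟩ : X i ∈ idealOfVars σ k)))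
    rw [mem_pow_idealOfVars_iff'] at h1
    have h3 := h1 (Finsupp.single i 1) (by simp)
    rw [← add_zero (Finsupp.single i 1), coeff_X_mul] at h3
    exact hc h3

/-- The linear form with a given vector of coefficients. -/
noncomputable def linearForm (σ K : Type*) [Fintype σ] [CommSemiring K] :
    (σ → K) →ₗ[K] MvPolynomial σ K :=
  Fintype.linearCombination K X

section LinearForm

variable {σ K : Type*} [Fintype σ] [CommSemiring K]

theorem linearForm_single [DecidableEq σ] (i : σ) :
    linearForm σ K (Pi.single i 1) = X i := by
  simp [linearForm, Fintype.linearCombination_apply_single]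

theorem isHomogeneous_linearForm (v : σ → K) : (linearForm σ K v).IsHomogeneous 1 := by
  rw [linearForm, Fintype.linearCombination_apply]
  exact IsHomogeneous.sum _ _ _ fun i _ ↦ by
    rw [smul_eq_C_mul]
    exact isHomogeneous_C_mul_X _ _

theorem coeff_linearForm (v : σ → K) (i : σ) :
    coeff (Finsupp.single i 1) (linearForm σ K v) = v i := by
  classical
  rw [linearForm, Fintype.linearCombination_apply, coeff_sum]
  simp [coeff_X, Finsupp.single_left_inj]

theorem eq_zero_of_linearForm_mem {v : σ → K} (h : linearForm σ K v ∈ idealOfVars σ K ^ 2) :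
    v = 0 := by
  ext i
  rw [← coeff_linearForm v i]
  exact (mem_pow_idealOfVars_iff' _ _).mp h _ (by simp)

end LinearForm

theorem exists_linearForm_isSMulRegular {σ K : Type*} [Fintype σ] [Nonempty σ] [Field K]
    [Infinite K] {J : Ideal (MvPolynomial σ K)} (hJ : J.IsRadical)
    (h2 : J ≤ idealOfVars σ K ^ 2) :
    ∃ w, IsSMulRegular (MvPolynomial σ K ⧸ J) (linearForm σ K w) := by
  classical
  have hfin := associatedPrimes.finite (MvPolynomial σ K) (MvPolynomial σ K ⧸ J)
  let F (p : Ideal (MvPolynomial σ K)) : Subspace K (σ → K) :=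
    (p.restrictScalars K).comap (linearForm σ K)
  have htop : ⊤ ∉ hfin.toFinset.image F := by
    intro h
    obtain ⟨p, hp, hpF⟩ := Finset.mem_image.mp h
    refine not_idealOfVars_le_of_mem_associatedPrimes hJ h2 (hfin.mem_toFinset.mp hp) ?_
    rw [Ideal.span_le]
    rintro _ ⟨i, rfl⟩
    have : Pi.single i 1 ∈ F p := hpF ▸ Submodule.mem_top
    rw [← linearForm_single]
    exact this
  obtain ⟨w, hw⟩ := (Set.ne_univ_iff_exists_notMem _).mp
    (Subspace.biUnion_ne_univ_of_top_notMem htop)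
  refine ⟨w, by_contra fun hreg ↦ hw ?_⟩
  have : linearForm σ K w ∈ ⋃ p ∈ associatedPrimes (MvPolynomial σ K) (MvPolynomial σ K ⧸ J),
      (p : Set (MvPolynomial σ K)) := by
    rw [biUnion_associatedPrimes_eq_compl_regular]
    exact hreg
  simp only [Set.mem_iUnion] at this ⊢
  obtain ⟨p, hp, hpw⟩ := this
  exact ⟨F p, Finset.mem_image_of_mem F (hfin.mem_toFinset.mpr hp), hpw⟩

theorem homogeneousSubmodule_two_eq_span (σ K : Type*) [CommSemiring K] :
    homogeneousSubmodule σ K 2 =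
      Submodule.span K (Set.range fun p : σ × σ ↦ (X p.1 * X p.2 : MvPolynomial σ K)) := by
  rw [← homogeneousSubmodule_one_pow, homogeneousSubmodule_one_eq_span_X, pow_two,
    Submodule.span_mul_span]
  congr 1
  ext f
  simp [Set.mem_mul]

theorem finrank_homogeneousSubmodule_two_le (σ K : Type*) [Fintype σ] [Field K] :
    Module.finrank K (homogeneousSubmodule σ K 2) ≤ (Fintype.card σ + 1).choose 2 := by
  classical
  have h : homogeneousSubmodule σ K 2 = Submodule.span K (Set.range
      (Sym2.lift ⟨fun i j ↦ (X i * X j : MvPolynomial σ K), fun i j ↦ mul_comm _ _⟩)) := by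
    rw [homogeneousSubmodule_two_eq_span]
    congr 1
    ext f
    constructor
    · rintro ⟨⟨i, j⟩, rfl⟩
      exact ⟨s(i, j), rfl⟩
    · rintro ⟨z, rfl⟩
      induction z with
      | _ i j => exact ⟨(i, j), rfl⟩
  rw [h, ← Sym2.card]
  exact finrank_range_le_card _

theorem exists_mul_sub_mul_mem {σ K ι : Type*} [Fintype σ] [Field K] [Fintype ι]
    (hι : Fintype.card ι = (Fintype.card σ).choose 2) {g : ι → MvPolynomial σ K}
    (hg : ∀ i, (g i).IsHomogeneous 2) (hli : LinearIndependent K g) {w : σ → K}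
    (hw : IsSMulRegular (MvPolynomial σ K ⧸ Ideal.span (Set.range g)) (linearForm σ K w))
    (u v : σ → K) : ∃ z, linearForm σ K u * linearForm σ K v -
      linearForm σ K z * linearForm σ K w ∈ Ideal.span (Set.range g) := by
  set J := Ideal.span (Set.range g)
  let Q := Submodule.span K (Set.range g)
  have hQJ : Q ≤ J.restrictScalars K := Submodule.span_le_restrictScalars _ _ _
  let μ : (σ → K) →ₗ[K] MvPolynomial σ K :=
    LinearMap.mulRight K (linearForm σ K w) ∘ₗ linearForm σ K
  have hμ (z) : μ z = linearForm σ K z * linearForm σ K w := rfl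
  have hJ : J ≤ idealOfVars σ K ^ 2 := span_range_le_idealOfVars_pow hg
  have hμJ {z} (hz : μ z ∈ J) : z = 0 := by
    refine eq_zero_of_linearForm_mem (hJ ?_)
    rw [← Ideal.Quotient.eq_zero_iff_mem] at hz ⊢
    refine hw.right_eq_zero_of_smul ?_
    rw [← hz, hμ, mul_comm]
    rfl
  have hdisj : Q ⊓ LinearMap.range μ = ⊥ := by
    rw [eq_bot_iff]
    rintro _ ⟨hQ, z, rfl⟩
    rw [hμJ (hQJ hQ)]
    simp
  have hsup : Q ⊔ LinearMap.range μ ≤ homogeneousSubmodule σ K 2 := by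
    refine sup_le (Submodule.span_le.mpr ?_) ?_
    · rintro _ ⟨i, rfl⟩
      exact hg i
    · rintro _ ⟨z, rfl⟩
      exact (isHomogeneous_linearForm z).mul (isHomogeneous_linearForm w)
  have : FiniteDimensional K (homogeneousSubmodule σ K 2) :=
    Module.Finite.iff_fg.mpr (homogeneousSubmodule_fg σ K 2)
  have hfin : Module.finrank K (homogeneousSubmodule σ K 2) ≤
      Module.finrank K (Q ⊔ LinearMap.range μ : Submodule K (MvPolynomial σ K)) := by
    refine (finrank_homogeneousSubmodule_two_le σ K).trans ?_
    have hQ : FiniteDimensional K Q := FiniteDimensional.span_of_finite K (Set.finite_range g)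
    have h := Submodule.finrank_sup_add_finrank_inf_eq Q (LinearMap.range μ)
    rw [hdisj, finrank_bot, add_zero, finrank_span_eq_card hli, hι,
      LinearMap.finrank_range_of_inj, Module.finrank_fintype_fun_eq_card] at h
    · rw [h, Nat.choose_succ_succ' _ 1, Nat.choose_one_right, add_comm]
    · rw [← LinearMap.ker_eq_bot, eq_bot_iff]
      intro z hz
      exact hμJ (by rw [LinearMap.mem_ker.mp hz]; exact J.zero_mem)
  have heq := Submodule.eq_of_le_of_finrank_le hsup hfin
  have huv : linearForm σ K u * linearForm σ K v ∈ Q ⊔ LinearMap.range μ := by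
    rw [heq]
    exact (isHomogeneous_linearForm u).mul (isHomogeneous_linearForm v)
  obtain ⟨q, hq, _, ⟨z, rfl⟩, h⟩ := Submodule.mem_sup.mp huv
  exact ⟨z, by rw [← h, hμ, add_sub_cancel_right]; exact hQJ hq⟩

/-- The edge ideal of the complete graph. -/
noncomputable def completeEdgeIdeal (σ K : Type*) [CommSemiring K] : Ideal (MvPolynomial σ K) :=
  Ideal.span {f | ∃ i j, i ≠ j ∧ f = X i * X j}

theorem X_mul_X_mem_completeEdgeIdeal {σ K : Type*} [CommSemiring K] {i j : σ} (h : i ≠ j) :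
    X i * X j ∈ completeEdgeIdeal σ K :=
  Ideal.subset_span ⟨i, j, h, rfl⟩

theorem IsHomogeneous.exists_sub_mem_completeEdgeIdeal {σ K : Type*} [Fintype σ] [DecidableEq σ]
    [CommRing K] {f : MvPolynomial σ K} (hf : f.IsHomogeneous 2) :
    ∃ c : σ → K, f - ∑ i, C (c i) * X i ^ 2 ∈ completeEdgeIdeal σ K := by
  rw [← mem_homogeneousSubmodule, homogeneousSubmodule_two_eq_span] at hf
  induction hf using Submodule.span_induction with
  | zero => exact ⟨0, by simp⟩
  | mem f hf =>
    obtain ⟨⟨i, j⟩, rfl⟩ := hf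
    by_cases hij : i = j
    · subst hij
      refine ⟨Pi.single i 1, ?_⟩
      rw [Finset.sum_eq_single i (fun j _ hj ↦ by simp [hj]) (by simp)]
      simp [pow_two]
    · exact ⟨0, by simpa using X_mul_X_mem_completeEdgeIdeal hij⟩
  | add f g _ _ hf hg =>
    obtain ⟨c, hc⟩ := hf
    obtain ⟨d, hd⟩ := hg
    refine ⟨c + d, ?_⟩
    convert Ideal.add_mem _ hc hd using 1
    simp only [Pi.add_apply, C_add, add_mul, Finset.sum_add_distrib]
    ring
  | smul a f _ hf =>
    obtain ⟨c, hc⟩ := hf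
    refine ⟨a • c, ?_⟩
    convert Ideal.mul_mem_left _ (C a) hc using 1
    simp only [Pi.smul_apply, smul_eq_mul, RingHom.map_mul, mul_sub, Finset.mul_sum, mul_assoc,
      smul_eq_C_mul]

/-- The linear change of coordinates attached to an automorphism of the space of linear forms. -/
noncomputable def linearSubst {σ K : Type*} [Fintype σ] [DecidableEq σ] [CommSemiring K]
    (s : (σ → K) →ₗ[K] (σ → K)) : MvPolynomial σ K →ₐ[K] MvPolynomial σ K :=
  aeval fun i ↦ linearForm σ K (s (Pi.single i 1))

theorem linearSubst_linearForm {σ K : Type*} [Fintype σ] [DecidableEq σ] [CommSemiring K]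
    (s : (σ → K) →ₗ[K] (σ → K)) (v : σ → K) :
    linearSubst s (linearForm σ K v) = linearForm σ K (s v) := by
  have : (linearSubst s).toLinearMap ∘ₗ linearForm σ K = linearForm σ K ∘ₗ s := by
    refine LinearMap.pi_ext' fun i ↦ LinearMap.ext_ring ?_
    simp [linearForm_single, linearSubst]
  exact LinearMap.congr_fun this v

theorem linearSubst_comp_linearSubst {σ K : Type*} [Fintype σ] [DecidableEq σ] [CommSemiring K]
    {s t : (σ → K) →ₗ[K] (σ → K)} (h : s ∘ₗ t = LinearMap.id) :
    (linearSubst s).comp (linearSubst t) = AlgHom.id K _ := by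
  ext i : 1
  rw [AlgHom.comp_apply, ← linearForm_single, linearSubst_linearForm, linearSubst_linearForm,
    ← LinearMap.comp_apply s, h]
  simp

theorem exists_algEquiv_map_eq_completeEdgeIdeal {σ K ι : Type*} [Fintype σ] [Nonempty σ]
    [Field K] [IsAlgClosed K] [Fintype ι] (hι : Fintype.card ι = (Fintype.card σ).choose 2)
    {g : ι → MvPolynomial σ K} (hg : ∀ i, (g i).IsHomogeneous 2) (hli : LinearIndependent K g)
    (hrad : (Ideal.span (Set.range g)).IsRadical) :
    ∃ φ : MvPolynomial σ K ≃ₐ[K] MvPolynomial σ K, (∀ i, (φ (X i)).IsHomogeneous 1) ∧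
      (∀ i, (φ.symm (X i)).IsHomogeneous 1) ∧
      (Ideal.span (Set.range g)).map φ = completeEdgeIdeal σ K := by
  classical
  set J := Ideal.span (Set.range g) with hJdef
  have hJ : J ≤ idealOfVars σ K ^ 2 := span_range_le_idealOfVars_pow hg
  have : IsReduced (MvPolynomial σ K ⧸ J) := (Ideal.isRadical_iff_quotient_reduced J).mp hrad
  obtain ⟨w, hw⟩ := exists_linearForm_isSMulRegular hrad hJ
  let β : (σ → K) →ₗ[K] MvPolynomial σ K ⧸ J :=
    (Ideal.Quotient.mkₐ K J).toLinearMap ∘ₗ linearForm σ K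
  have hβ (v) : β v = Ideal.Quotient.mk J (linearForm σ K v) := rfl
  obtain ⟨s, hs⟩ := exists_linearEquiv_mul_eq_zero β
    (by
      rw [← LinearMap.ker_eq_bot, eq_bot_iff]
      exact fun v hv ↦ eq_zero_of_linearForm_mem (hJ (Ideal.Quotient.eq_zero_iff_mem.mp hv)))
    w
    (by
      rw [mem_nonZeroDivisors_iff_right]
      intro x hx
      refine hw.right_eq_zero_of_smul ?_
      rw [← hx, mul_comm]
      rfl)
    (fun u v ↦ by
      obtain ⟨z, hz⟩ := exists_mul_sub_mul_mem hι hg hli hw u v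
      refine ⟨z, ?_⟩
      simp only [hβ]
      rw [← RingHom.map_mul, ← RingHom.map_mul]
      exact Ideal.Quotient.eq.mpr hz)
  let φ : MvPolynomial σ K ≃ₐ[K] MvPolynomial σ K :=
    AlgEquiv.ofAlgHom (linearSubst s.toLinearMap) (linearSubst s.symm.toLinearMap)
      (linearSubst_comp_linearSubst (by ext; simp)) (linearSubst_comp_linearSubst (by ext; simp))
  have hφ (v) : φ (linearForm σ K v) = linearForm σ K (s v) := linearSubst_linearForm _ v
  have hφsymm (v) : φ.symm (linearForm σ K v) = linearForm σ K (s.symm v) :=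
    linearSubst_linearForm _ v
  have hφhom {n} {f : MvPolynomial σ K} (hf : f.IsHomogeneous n) : (φ f).IsHomogeneous n := by
    have := hf.aeval (fun i ↦ linearForm σ K (s (Pi.single i 1)))
      (fun i ↦ isHomogeneous_linearForm _)
    rwa [one_mul] at this
  have hmem (f) : f ∈ J.map φ ↔ φ.symm f ∈ J := by
    have : J.map φ = J.comap φ.symm := (Ideal.comap_symm φ.toRingEquiv).symm
    rw [this, Ideal.mem_comap]
  have hE : completeEdgeIdeal σ K ≤ J.map φ := by
    rw [completeEdgeIdeal, Ideal.span_le]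
    rintro _ ⟨i, j, hij, rfl⟩
    rw [SetLike.mem_coe, hmem, map_mul, ← linearForm_single, ← linearForm_single, hφsymm, hφsymm,
      ← Ideal.Quotient.eq_zero_iff_mem, map_mul]
    exact hs i j hij
  refine ⟨φ, fun i ↦ hφhom (isHomogeneous_X K i), fun i ↦ ?_, le_antisymm ?_ hE⟩
  · rw [← linearForm_single, hφsymm]
    exact isHomogeneous_linearForm _
  rw [hJdef, Ideal.map_le_iff_le_comap, Ideal.span_le]
  rintro _ ⟨i, rfl⟩
  obtain ⟨c, hc⟩ := (hφhom (hg i)).exists_sub_mem_completeEdgeIdeal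
  suffices h0 : ∀ j, c j = 0 by simpa [h0] using hc
  intro j
  by_contra hcj
  have hsum : ∑ i, C (c i) * X i ^ 2 ∈ J.map φ := by
    have h := Ideal.sub_mem _ (Ideal.mem_map_of_mem φ (Ideal.subset_span ⟨i, rfl⟩ : g i ∈ J))
      (hE hc)
    rwa [sub_sub_cancel] at h
  have hrest : ∑ i ∈ Finset.univ.erase j, C (c i) * X i ^ 2 * X j ∈ J.map φ :=
    Ideal.sum_mem _ fun i hi ↦ by
      have h := Ideal.mul_mem_left (J.map φ) (C (c i) * X i)
        (hE (X_mul_X_mem_completeEdgeIdeal (Finset.ne_of_mem_erase hi)))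
      convert h using 1
      ring
  have hcube : C (c j) * X j ^ 3 ∈ J.map φ := by
    have h := Ideal.sub_mem _ (Ideal.mul_mem_right (X j) _ hsum) hrest
    rw [Finset.sum_mul, ← Finset.add_sum_erase _ _ (Finset.mem_univ j), add_sub_cancel_right] at h
    convert h using 1
    ring
  have hX : φ.symm (X j) ∈ J := by
    refine hrad ⟨3, ?_⟩
    rw [← map_pow, ← hmem]
    have h := Ideal.mul_mem_left _ (C (c j)⁻¹) hcube
    rwa [← mul_assoc, ← C_mul, inv_mul_cancel₀ hcj, C_1, one_mul] at h
  rw [← linearForm_single, hφsymm] at hX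
  have h := congrFun (s.symm.map_eq_zero_iff.mp (eq_zero_of_linearForm_mem (hJ hX))) j
  simp at h

section Monomials

variable {σ K : Type*} [Fintype σ]

theorem monomial_mem_completeEdgeIdeal_pow [CommSemiring K] (m : ℕ) (c : σ →₀ ℕ)
    (h2 : 2 * m ≤ c.degree) (h : ∀ i, c i + m ≤ c.degree) (r : K) :
    monomial c r ∈ completeEdgeIdeal σ K ^ m := by
  classical
  induction m generalizing c with
  | zero => simp
  | succ m ih =>
    have hsum : c.degree = ∑ i, c i := Finsupp.degree_eq_sum c
    have hne : Nonempty σ := by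
      by_contra hσ
      rw [not_nonempty_iff] at hσ
      rw [hsum, Finset.univ_eq_empty, Finset.sum_empty] at h2
      omega
    obtain ⟨i, hi⟩ := Finite.exists_max c
    have hsumi : c.degree = c i + ∑ l ∈ Finset.univ.erase i, c l := by
      rw [hsum, Finset.add_sum_erase _ _ (Finset.mem_univ i)]
    have hpos : 0 < ∑ l ∈ Finset.univ.erase i, c l := by have := h i; omega
    obtain ⟨j', hj', hcj'⟩ := Finset.exists_ne_zero_of_sum_ne_zero hpos.ne'
    obtain ⟨j, hj, hjmax⟩ := Finset.exists_max_image (Finset.univ.erase i) c ⟨j', hj'⟩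
    have hji : j ≠ i := Finset.ne_of_mem_erase hj
    have hsumij : c.degree = c i + (c j + ∑ l ∈ (Finset.univ.erase i).erase j, c l) := by
      rw [hsumi, Finset.add_sum_erase _ _ hj]
    have hcj : 1 ≤ c j := by have := hjmax j' hj'; omega
    have hci : 1 ≤ c i := hcj.trans (hi j)
    have hle : Finsupp.single i 1 + Finsupp.single j 1 ≤ c := by
      intro l
      rcases eq_or_ne l i with rfl | hl
      · simpa [Finsupp.single_apply, hji] using hci
      · rcases eq_or_ne l j with rfl | hl'
        · simpa [Finsupp.single_apply, hl.symm] using hcj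
        · simp [hl, hl']
    obtain ⟨c', rfl⟩ := exists_add_of_le hle
    have hdeg : (Finsupp.single i 1 + Finsupp.single j 1 + c').degree = 2 + c'.degree := by
      simp
    rw [hdeg] at h2 h hsumij
    have hmon : monomial (Finsupp.single i 1 + Finsupp.single j 1 + c') r =
        X i * X j * monomial c' r := by
      simp only [X, monomial_mul, one_mul]
    rw [hmon, pow_succ']
    refine Ideal.mul_mem_mul (X_mul_X_mem_completeEdgeIdeal hji.symm) (ih c' (by omega) fun l ↦ ?_)
    rcases eq_or_ne l i with rfl | hl
    · have := h l
      simp [hji] at this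
      omega
    rcases eq_or_ne l j with rfl | hl'
    · have := h l
      simp [hl.symm] at this
      omega
    have h1 := h l
    have h3 := hi l
    have h4 := hjmax l (by simp [hl])
    have h5 := Finset.single_le_sum
      (f := fun l ↦ (Finsupp.single i 1 + Finsupp.single j 1 + c' : σ →₀ ℕ) l)
      (fun _ _ ↦ Nat.zero_le _) (show l ∈ (Finset.univ.erase i).erase j by simp [hl, hl'])
    simp [Finsupp.single_apply, hl, hl', hji, hji.symm] at h1 h3 h4 h5 hsumij
    omega

theorem mem_completeEdgeIdeal_pow_of_support [CommSemiring K] {m : ℕ} {f : MvPolynomial σ K}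
    (hf : ∀ c ∈ f.support, 2 * m ≤ c.degree ∧ ∀ i, c i + m ≤ c.degree) :
    f ∈ completeEdgeIdeal σ K ^ m := by
  rw [← support_sum_monomial_coeff f]
  exact Ideal.sum_mem _ fun c hc ↦ monomial_mem_completeEdgeIdeal_pow m c (hf c hc).1 (hf c hc).2 _

end Monomials

section Points

variable {σ K : Type*} [DecidableEq σ] [Field K]

theorem le_degree_of_mem_completeEdgeIdeal_pow {m : ℕ} {f : MvPolynomial σ K}
    (hf : f ∈ completeEdgeIdeal σ K ^ m) (i : σ) : ∀ c ∈ f.support, c i + m ≤ c.degree := by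
  induction m generalizing f with
  | zero => exact fun c _ ↦ by simpa using Finsupp.le_degree i c
  | succ m ih =>
    rw [pow_succ'] at hf
    refine Submodule.mul_induction_on hf (fun e he g hg ↦ ?_) fun f g hf hg c hc ↦ ?_
    · induction he using Submodule.span_induction with
      | mem e he =>
        intro c hc
        obtain ⟨a, b, hab, rfl⟩ := he
        obtain ⟨d, hd, d', hd', rfl⟩ := Finset.mem_add.mp (support_mul _ _ hc)
        obtain ⟨u, hu, v, hv, rfl⟩ := Finset.mem_add.mp (support_mul _ _ hd)
        rw [support_X, Finset.mem_singleton] at hu hv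
        subst hu hv
        have := ih hg d' hd'
        have h1 : (Finsupp.single a 1 + Finsupp.single b 1 : σ →₀ ℕ) i ≤ 1 := by
          rcases eq_or_ne a i with rfl | ha
          · simp [hab.symm]
          · simp only [Finsupp.add_apply, Finsupp.single_apply, ha, if_false]
            split_ifs <;> simp
        simp only [Finsupp.add_apply, map_add, Finsupp.degree_single] at h1 ⊢
        omega
      | zero => simp
      | add e e' _ _ h h' =>
        intro c hc
        rw [add_mul] at hc
        exact (Finset.mem_union.mp (support_add hc)).elim (h c) (h' c)
      | smul r e _ h =>
        intro c hc
        rw [smul_mul_assoc, smul_eq_mul] at hc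
        obtain ⟨d, hd, d', hd', rfl⟩ := Finset.mem_add.mp (support_mul _ _ hc)
        have := h d' hd'
        have h1 := Finsupp.le_degree i d
        simp only [Finsupp.add_apply, map_add] at h1 ⊢
        omega
    · exact (Finset.mem_union.mp (support_add hc)).elim (hf c) (hg c)

/-- The ideal of the `i`-th coordinate point. -/
noncomputable def coordinatePointIdeal (K : Type*) [Field K] (i : σ) : Ideal (MvPolynomial σ K) :=
  RingHom.ker (aeval (fun j ↦ if j = i then Polynomial.X else 0) :
    MvPolynomial σ K →ₐ[K] Polynomial K)

theorem isPrime_coordinatePointIdeal (i : σ) : (coordinatePointIdeal K i).IsPrime :=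
  RingHom.ker_isPrime _

theorem X_notMem_coordinatePointIdeal (i : σ) : X i ∉ coordinatePointIdeal K i := by
  simp [coordinatePointIdeal, RingHom.mem_ker]

theorem completeEdgeIdeal_le_coordinatePointIdeal (i : σ) :
    completeEdgeIdeal σ K ≤ coordinatePointIdeal K i := by
  rw [completeEdgeIdeal, Ideal.span_le]
  rintro _ ⟨a, b, hab, rfl⟩
  rw [SetLike.mem_coe, coordinatePointIdeal, RingHom.mem_ker, map_mul, aeval_X, aeval_X]
  rcases eq_or_ne a i with rfl | ha
  · simp [hab.symm]
  · simp [ha]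

theorem exists_mem_support_of_notMem_coordinatePointIdeal {i : σ} {s : MvPolynomial σ K}
    (hs : s ∉ coordinatePointIdeal K i) : ∃ a ∈ s.support, ∀ j ≠ i, a j = 0 := by
  contrapose! hs
  rw [coordinatePointIdeal, RingHom.mem_ker, ← support_sum_monomial_coeff s, map_sum]
  refine Finset.sum_eq_zero fun a ha ↦ ?_
  obtain ⟨j, hj, haj⟩ := hs a ha
  rw [aeval_monomial, Finsupp.prod,
    Finset.prod_eq_zero (Finsupp.mem_support_iff.mpr haj) (by simp [hj, haj]), mul_zero]

theorem le_degree_of_mul_mem_completeEdgeIdeal_pow {m : ℕ} {i : σ} {s f : MvPolynomial σ K}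
    (hs : s ∉ coordinatePointIdeal K i) (hsf : s * f ∈ completeEdgeIdeal σ K ^ m)
    {c : σ →₀ ℕ} (hc : c ∈ f.support) : c i + m ≤ c.degree := by
  obtain ⟨a, ha, ha0⟩ := exists_mem_support_of_notMem_coordinatePointIdeal hs
  let w : σ → ℕ := fun j ↦ if j = i then 0 else 1
  have hw (d : σ →₀ ℕ) : d.weight w + d i = d.degree := by
    induction d using Finsupp.induction_linear with
    | zero => simp
    | add d e hd he =>
      simp only [map_add, Finsupp.add_apply]
      omega
    | single j n =>
      rcases eq_or_ne j i with rfl | hj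
      · simp [w, Finsupp.weight_single]
      · simp [w, Finsupp.weight_single, hj]
  have h1 : (s : MvPowerSeries σ K).weightedOrder w ≤ 0 := by
    refine (MvPowerSeries.weightedOrder_le w (d := a) ?_).trans ?_
    · rwa [coeff_coe, ← mem_support_iff]
    · have : a.degree = a i := by
        have : a = Finsupp.single i (a i) := by
          ext j
          rcases eq_or_ne j i with rfl | hj
          · simp
          · simp [ha0 j hj, hj]
        rw [this, Finsupp.degree_single, Finsupp.single_eq_same]
      have := hw a
      exact_mod_cast (by omega : a.weight w ≤ 0)
  have h2 : (m : ℕ∞) ≤ ((s * f : MvPolynomial σ K) : MvPowerSeries σ K).weightedOrder w := by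
    refine MvPowerSeries.nat_le_weightedOrder w fun d hd ↦ ?_
    rw [coeff_coe]
    by_contra hne
    have := le_degree_of_mem_completeEdgeIdeal_pow hsf i d (mem_support_iff.mpr hne)
    have := hw d
    omega
  have h3 : (f : MvPowerSeries σ K).weightedOrder w ≤ c.weight w :=
    MvPowerSeries.weightedOrder_le w (by rwa [coeff_coe, ← mem_support_iff])
  rw [coe_mul, MvPowerSeries.weightedOrder_mul] at h2
  have h4 : m ≤ c.weight w := by
    have := h2.trans (add_le_add h1 h3)
    rw [zero_add] at this
    exact_mod_cast this
  have := hw c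
  omega

end Points

section CoeffMap

variable {σ k K : Type*} [Field k] [Field K] [Algebra k K]

/-- The map on polynomials applying a linear functional to each coefficient. -/
noncomputable def coeffMap (σ : Type*) (l : K →ₗ[k] k) :
    MvPolynomial σ K →+ MvPolynomial σ k where
  toFun := AddMonoidAlgebra.map l.toAddMonoidHom
  map_zero' := AddMonoidAlgebra.map_zero _
  map_add' := AddMonoidAlgebra.map_add _

theorem coeff_coeffMap (l : K →ₗ[k] k) (f : MvPolynomial σ K) (d : σ →₀ ℕ) :
    coeff d (coeffMap σ l f) = l (coeff d f) := rfl

theorem coeffMap_map_mul (l : K →ₗ[k] k) (a : MvPolynomial σ k) (f : MvPolynomial σ K) :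
    coeffMap σ l (map (algebraMap k K) a * f) = a * coeffMap σ l f := by
  classical
  ext d
  simp only [coeff_coeffMap, coeff_mul, map_sum, coeff_map, ← Algebra.smul_def, map_smul,
    smul_eq_mul]

theorem coeffMap_mem_of_mem_map (l : K →ₗ[k] k) {I : Ideal (MvPolynomial σ k)}
    {f : MvPolynomial σ K} (hf : f ∈ I.map (map (algebraMap k K))) : coeffMap σ l f ∈ I := by
  suffices h : ∀ r, coeffMap σ l (r * f) ∈ I by simpa using h 1
  rw [Ideal.map] at hf
  induction hf using Submodule.span_induction with
  | zero => simp
  | mem f hf =>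
    obtain ⟨a, ha, rfl⟩ := hf
    intro r
    rw [mul_comm, coeffMap_map_mul]
    exact I.mul_mem_right _ ha
  | add f g _ _ hf hg =>
    intro r
    rw [mul_add, map_add]
    exact I.add_mem (hf r) (hg r)
  | smul s f _ hf =>
    intro r
    rw [smul_eq_mul, ← mul_assoc]
    exact hf (r * s)

end CoeffMap

end MvPolynomial

theorem mem_symbolicPower_iff {R : Type*} [CommRing R] {I : Ideal R} {m : ℕ} {f : R} :
    f ∈ symbolicPower I m ↔ ∀ p ∈ associatedPrimes R (R ⧸ I), ∃ s ∉ p, s * f ∈ I ^ m := by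
  simp only [symbolicPower, Submodule.mem_iInf, Subtype.forall]
  refine forall₂_congr fun p hp ↦ ?_
  have : p.IsPrime := hp.isPrime
  rw [Ideal.mem_comap, IsLocalization.algebraMap_mem_map_algebraMap_iff p.primeCompl]
  rfl

theorem mem_associatedPrimes_of_ringKrullDim_le {R : Type*} [CommRing R] [IsNoetherianRing R]
    {I p q : Ideal R} [hp : p.IsPrime] [hq : q.IsPrime] (hIp : I ≤ p) (hpq : p < q) {n : ℕ}
    (hn : idealHeight I = n) (hdim : ringKrullDim R ≤ (n + 1 : ℕ)) :
    p ∈ associatedPrimes R (R ⧸ I) := by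
  obtain ⟨p', hp', hle⟩ := Ideal.exists_minimalPrimes_le hIp
  have hp'prime : p'.IsPrime := hp'.1.1
  have h1 : (n : ℕ∞) ≤ Order.height (⟨p', hp'prime⟩ : PrimeSpectrum R) :=
    hn ▸ iInf₂_le (⟨p', hp'prime⟩ : PrimeSpectrum R) hp'.1.2
  rcases hle.eq_or_lt with rfl | hlt
  · apply Module.associatedPrimes.minimalPrimes_annihilator_subset_associatedPrimes
    rwa [Ideal.annihilator_quotient]
  have h2 : Order.height (⟨p', hp'prime⟩ : PrimeSpectrum R) + 1 ≤
      Order.height (⟨p, hp⟩ : PrimeSpectrum R) := Order.height_add_one_le hlt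
  have h3 : Order.height (⟨p, hp⟩ : PrimeSpectrum R) + 1 ≤
      Order.height (⟨q, hq⟩ : PrimeSpectrum R) := Order.height_add_one_le hpq
  have h4 : (Order.height (⟨q, hq⟩ : PrimeSpectrum R) : WithBot ℕ∞) ≤ ((n + 1 : ℕ) : ℕ∞) :=
    (Order.height_le_krullDim _).trans hdim
  have h5 : ((n + 1 + 1 : ℕ) : ℕ∞) ≤ ((n + 1 : ℕ) : ℕ∞) :=
    calc ((n + 1 + 1 : ℕ) : ℕ∞) = (n : ℕ∞) + 1 + 1 := by push_cast; rfl
      _ ≤ _ := (add_le_add_left ((add_le_add_left h1 1).trans h2) 1).trans h3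
      _ ≤ _ := WithBot.coe_le_coe.mp h4
  rw [Nat.cast_le] at h5
  omega

theorem exists_finsupp_le_degree_eq {σ : Type*} [Fintype σ] (b s : ℕ)
    (hs : s ≤ Fintype.card σ * b) : ∃ a : σ →₀ ℕ, (∀ i, a i ≤ b) ∧ a.degree = s := by
  classical
  induction s with
  | zero => exact ⟨0, by simp, by simp⟩
  | succ s ih =>
    obtain ⟨a, ha, hdeg⟩ := ih (by omega)
    obtain ⟨i, hi⟩ : ∃ i, a i < b := by
      by_contra! h
      have := Finset.card_nsmul_le_sum Finset.univ a b fun i _ ↦ h i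
      rw [← Finsupp.degree_eq_sum, Finset.card_univ, smul_eq_mul] at this
      omega
    refine ⟨a + Finsupp.single i 1, fun j ↦ ?_, by simp [hdeg]⟩
    rcases eq_or_ne i j with rfl | hj
    · simpa using hi
    · simpa [Finsupp.single_apply, hj] using ha j

theorem linearIndependent_of_forall_le_of_span_eq {k S : Type*} [Field k] [CommRing S] [Algebra k S]
    {n : ℕ} (g : Fin n → S)
    (hmin : ∀ (r : ℕ) (f : Fin r → S),
      Ideal.span (Set.range f) = Ideal.span (Set.range g) → n ≤ r) : LinearIndependent k g := by
  by_contra h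
  rw [linearIndependent_iff_notMem_span] at h
  push Not at h
  obtain ⟨i, hi⟩ := h
  obtain _ | n := n
  · exact i.elim0
  refine absurd (hmin n (g ∘ i.succAbove) (le_antisymm (Ideal.span_mono ?_) ?_)) (by omega)
  · exact Set.range_comp_subset_range _ _
  · rw [Ideal.span_le]
    rintro _ ⟨j, rfl⟩
    rcases eq_or_ne j i with rfl | hj
    · rw [Set.range_comp, Fin.range_succAbove, Set.compl_eq_univ_sdiff]
      exact Submodule.span_le_restrictScalars k S _ hi
    · obtain ⟨l, rfl⟩ := Fin.exists_succAbove_eq hj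
      exact Ideal.subset_span ⟨l, rfl⟩

namespace MvPolynomial

section BaseChange

variable {σ k K : Type*} [Field k] [Field K] [Algebra k K]

theorem linearIndependent_map {ι : Type*} [Finite ι] {g : ι → MvPolynomial σ k}
    (hg : LinearIndependent k g) :
    LinearIndependent K fun i ↦ map (algebraMap k K) (g i) := by
  cases nonempty_fintype ι
  rw [Fintype.linearIndependent_iff] at hg ⊢
  intro c hc i
  rw [← Module.forall_dual_apply_eq_zero_iff k]
  intro l
  refine hg (fun i ↦ l (c i)) ?_ i
  ext d
  have := congrArg l (congrArg (coeff d) hc)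
  simp only [coeff_sum, coeff_smul, coeff_map, smul_eq_mul, mul_comm (c _), ← Algebra.smul_def,
    map_sum, map_smul, coeff_zero, map_zero] at this
  simpa only [coeff_sum, coeff_smul, smul_eq_mul, mul_comm (l _), coeff_zero] using this

theorem mem_of_map_mem_map {I : Ideal (MvPolynomial σ k)} {f : MvPolynomial σ k}
    (hf : map (algebraMap k K) f ∈ I.map (map (algebraMap k K))) : f ∈ I := by
  obtain ⟨l, hl⟩ : ∃ l : Module.Dual k K, l 1 ≠ 0 := by
    by_contra! h
    exact one_ne_zero ((Module.forall_dual_apply_eq_zero_iff k (1 : K)).mp h)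
  have h := coeffMap_mem_of_mem_map l hf
  rw [← mul_one (map _ f), coeffMap_map_mul] at h
  have h1 : coeffMap σ l 1 = C (l 1) := by
    classical
    ext d
    rw [coeff_coeffMap, coeff_one, coeff_C]
    split_ifs <;> simp
  have := I.mul_mem_right (C (l 1)⁻¹) h
  rwa [h1, mul_assoc, ← C_mul, mul_inv_cancel₀ hl, C_1, mul_one] at this

end BaseChange

section Main

variable {σ k K : Type*} [Field k] [Field K]

theorem le_degree_of_mem_symbolicPower [DecidableEq σ] {R : Type*} [CommRing R] {I : Ideal R}
    {Ψ : R →+* MvPolynomial σ K} {i : σ} {m : ℕ} (hI : (I ^ m).map Ψ ≤ completeEdgeIdeal σ K ^ m)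
    (hi : (coordinatePointIdeal K i).comap Ψ ∈ associatedPrimes R (R ⧸ I)) {f : R}
    (hf : f ∈ symbolicPower I m) {c : σ →₀ ℕ} (hc : c ∈ (Ψ f).support) : c i + m ≤ c.degree := by
  obtain ⟨s, hs, hsf⟩ := mem_symbolicPower_iff.mp hf _ hi
  refine le_degree_of_mul_mem_completeEdgeIdeal_pow (s := Ψ s) hs ?_ hc
  rw [← map_mul]
  exact hI (Ideal.mem_map_of_mem Ψ hsf)

theorem mem_symbolicPower_of_forall_mul_mem [Finite σ] [Nonempty σ] {I : Ideal (MvPolynomial σ k)}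
    (hI : I.IsRadical) (h2 : I ≤ idealOfVars σ k ^ 2) {m t : ℕ} {h : MvPolynomial σ k}
    (hh : ∀ u ∈ idealOfVars σ k ^ t, u * h ∈ I ^ m) : h ∈ symbolicPower I m := by
  rw [mem_symbolicPower_iff]
  intro p hp
  have : p.IsPrime := hp.isPrime
  have hle : ¬ idealOfVars σ k ^ t ≤ p := fun hle ↦
    not_idealOfVars_le_of_mem_associatedPrimes hI h2 hp (Ideal.IsPrime.le_of_pow_le hle)
  obtain ⟨s, hs, hsp⟩ := SetLike.not_le_iff_exists.mp hle
  exact ⟨s, hsp, hh s hs⟩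

theorem map_idealOfVars_pow_le {R : Type*} [CommSemiring R]
    {φ : MvPolynomial σ R →ₐ[R] MvPolynomial σ R} (hφ : ∀ i, (φ (X i)).IsHomogeneous 1) (n : ℕ) :
    (idealOfVars σ R ^ n).map φ ≤ idealOfVars σ R ^ n := by
  rw [Ideal.map_pow]
  refine Ideal.pow_right_mono ?_ n
  rw [Ideal.map_span, Ideal.span_le]
  rintro _ ⟨_, ⟨i, rfl⟩, rfl⟩
  rw [SetLike.mem_coe, ← pow_one (idealOfVars σ R), mem_pow_idealOfVars_iff']
  exact fun x hx ↦ (hφ i).coeff_eq_zero hx.ne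

theorem constantCoeff_algHom_apply {R : Type*} [CommSemiring R]
    {φ : MvPolynomial σ R →ₐ[R] MvPolynomial σ R} (hφ : ∀ i, (φ (X i)).IsHomogeneous 1)
    (f : MvPolynomial σ R) : constantCoeff (φ f) = constantCoeff f := by
  induction f using MvPolynomial.induction_on with
  | C a => rw [← algebraMap_eq, AlgHom.commutes]
  | add f g hf hg => simp only [map_add, hf, hg]
  | mul_X f i hf =>
    rw [map_mul, map_mul, map_mul, constantCoeff_X, constantCoeff_eq,
      (hφ i).coeff_eq_zero (by simp), mul_zero, mul_zero]

theorem map_mem_idealOfVars_pow {R S : Type*} [CommSemiring R] [CommSemiring S] (ψ : R →+* S)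
    {n : ℕ} {f : MvPolynomial σ R} (hf : f ∈ idealOfVars σ R ^ n) :
    map ψ f ∈ idealOfVars σ S ^ n := by
  rw [mem_pow_idealOfVars_iff'] at hf ⊢
  intro x hx
  rw [coeff_map, hf x hx, map_zero]

theorem constantCoeff_eq_zero_of_mem_coordinatePointIdeal [DecidableEq σ] {i : σ}
    {f : MvPolynomial σ K} (hf : f ∈ coordinatePointIdeal K i) : constantCoeff f = 0 := by
  have h : (Polynomial.constantCoeff : Polynomial K →+* K).comp
      ((aeval (fun j ↦ if j = i then Polynomial.X else 0) :
        MvPolynomial σ K →ₐ[K] Polynomial K) : MvPolynomial σ K →+* Polynomial K) =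
      constantCoeff := by
    ext j
    · simp
    · by_cases hj : j = i <;> simp [hj]
  rw [← h, RingHom.comp_apply, RingHom.coe_coe, RingHom.mem_ker.mp hf, map_zero]

variable [Algebra k K] {I : Ideal (MvPolynomial σ k)}
  {φ : MvPolynomial σ K ≃ₐ[K] MvPolynomial σ K}

theorem map_comp_map_pow (hI : (I.map (map (algebraMap k K))).map φ = completeEdgeIdeal σ K)
    (m : ℕ) : ((I ^ m).map (map (algebraMap k K))).map φ = completeEdgeIdeal σ K ^ m := by
  rw [Ideal.map_pow, Ideal.map_pow, hI]

theorem mem_map_pow_iff (hI : (I.map (map (algebraMap k K))).map φ = completeEdgeIdeal σ K)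
    (m : ℕ) (y : MvPolynomial σ K) :
    y ∈ (I ^ m).map (map (algebraMap k K)) ↔ φ y ∈ completeEdgeIdeal σ K ^ m := by
  rw [← map_comp_map_pow hI m]
  refine ⟨fun h ↦ Ideal.mem_map_of_mem φ h, fun h ↦ ?_⟩
  obtain ⟨z, hz, hzy⟩ := (Ideal.mem_map_of_equiv φ _).mp h
  rwa [← φ.injective hzy]

theorem comap_coordinatePointIdeal_mem_associatedPrimes [DecidableEq σ] [Finite σ]
    (hφ : ∀ i, (φ (X i)).IsHomogeneous 1) (hφ' : ∀ i, (φ.symm (X i)).IsHomogeneous 1)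
    (hI : (I.map (map (algebraMap k K))).map φ = completeEdgeIdeal σ K)
    {n : ℕ} (hn : Nat.card σ = n + 1) (hht : idealHeight I = n) (i : σ) :
    (coordinatePointIdeal K i).comap
      ((φ : MvPolynomial σ K →+* MvPolynomial σ K).comp (map (algebraMap k K))) ∈
      associatedPrimes (MvPolynomial σ k) (MvPolynomial σ k ⧸ I) := by
  have hP := isPrime_coordinatePointIdeal (K := K) i
  have hq : (RingHom.ker (constantCoeff : MvPolynomial σ k →+* k)).IsPrime :=
    RingHom.ker_isPrime _
  refine mem_associatedPrimes_of_ringKrullDim_le (hp := Ideal.comap_isPrime _ _) (hq := hq)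
    ?_ (lt_of_le_of_ne ?_ ?_) hht ?_
  · rw [← Ideal.map_le_iff_le_comap, ← Ideal.map_map]
    exact hI.le.trans (completeEdgeIdeal_le_coordinatePointIdeal i)
  · intro f hf
    have h := constantCoeff_eq_zero_of_mem_coordinatePointIdeal (Ideal.mem_comap.mp hf)
    rw [RingHom.comp_apply] at h
    have h' := (constantCoeff_algHom_apply (φ := (φ : MvPolynomial σ K →ₐ[K] MvPolynomial σ K)) hφ
      (map (algebraMap k K) f)).symm.trans h
    rwa [constantCoeff_map, map_eq_zero] at h'
  · intro heq
    have hX (j : σ) : φ (X j) ∈ coordinatePointIdeal K i := by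
      have : (X j : MvPolynomial σ k) ∈ RingHom.ker (constantCoeff : MvPolynomial σ k →+* k) :=
        constantCoeff_X k j
      rw [← heq] at this
      simpa using this
    have hle : (idealOfVars σ K).map (φ : MvPolynomial σ K →+* MvPolynomial σ K) ≤
        coordinatePointIdeal K i := by
      rw [Ideal.map_span, Ideal.span_le]
      rintro _ ⟨_, ⟨j, rfl⟩, rfl⟩
      exact hX j
    refine X_notMem_coordinatePointIdeal (K := K) i ?_
    have hmem : φ.symm (X i) ∈ idealOfVars σ K := by
      rw [← pow_one (idealOfVars σ K), mem_pow_idealOfVars_iff']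
      exact fun x hx ↦ (hφ' i).coeff_eq_zero hx.ne
    simpa using hle (Ideal.mem_map_of_mem _ hmem)
  · rw [ringKrullDim_of_isNoetherianRing, ringKrullDim_eq_zero_of_field, zero_add, hn]

theorem mul_mem_pow_of_mem_symbolicPower [Fintype σ]
    (hφ : ∀ i, (φ (X i)).IsHomogeneous 1) (hφ' : ∀ i, (φ.symm (X i)).IsHomogeneous 1)
    (hI : (I.map (map (algebraMap k K))).map φ = completeEdgeIdeal σ K)
    {n m : ℕ} (hn : Fintype.card σ = n + 2) (hht : idealHeight I = (n + 1 : ℕ))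
    {f g : MvPolynomial σ k} (hf : f ∈ idealOfVars σ k ^ (m * n / (n + 1)))
    (hg : g ∈ symbolicPower I m) : f * g ∈ I ^ m := by
  classical
  set d := m * n / (n + 1) with hd
  refine mem_of_map_mem_map (K := K) ((mem_map_pow_iff hI m _).mpr ?_)
  refine mem_completeEdgeIdeal_pow_of_support fun c hc ↦ ?_
  rw [map_mul, map_mul] at hc
  obtain ⟨b, hb, a, ha, rfl⟩ := Finset.mem_add.mp (support_mul _ _ hc)
  have hbd : d ≤ b.degree := by
    have h := map_idealOfVars_pow_le (φ := (φ : _ →ₐ[K] _)) hφ d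
      (Ideal.mem_map_of_mem _ (map_mem_idealOfVars_pow (algebraMap k K) hf))
    by_contra! hlt
    exact mem_support_iff.mp hb ((mem_pow_idealOfVars_iff' _ _).mp h b hlt)
  have hai (i : σ) : a i + m ≤ a.degree := by
    refine le_degree_of_mem_symbolicPower ?_
      (comap_coordinatePointIdeal_mem_associatedPrimes hφ hφ' hI
        (by rw [Nat.card_eq_fintype_card, hn]) hht i) hg ha
    rw [← Ideal.map_map]
    exact (map_comp_map_pow hI m).le
  have hsum : a.degree + (n + 2) * m ≤ (n + 2) * a.degree := by
    have := Finset.sum_le_sum fun i (_ : i ∈ Finset.univ) ↦ hai i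
    rw [Finset.sum_add_distrib, ← Finsupp.degree_eq_sum] at this
    simpa [hn] using this
  have hlt : m * n < (n + 1) * (d + 1) := by
    rw [hd]
    exact Nat.lt_mul_div_succ _ n.succ_pos
  rw [map_add]
  constructor
  · by_contra! hcon
    nlinarith
  · intro i
    have := hai i
    have := Finsupp.le_degree i b
    rw [Finsupp.add_apply]
    omega

theorem mem_idealOfVars_pow_of_forall_mul_mem [Fintype σ]
    (hφ : ∀ i, (φ (X i)).IsHomogeneous 1) (hφ' : ∀ i, (φ.symm (X i)).IsHomogeneous 1)
    (hI : (I.map (map (algebraMap k K))).map φ = completeEdgeIdeal σ K)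
    (hrad : I.IsRadical) (h2 : I ≤ idealOfVars σ k ^ 2)
    {n m : ℕ} (hn : Fintype.card σ = n + 2)
    {f : MvPolynomial σ k} (hf : ∀ g ∈ symbolicPower I m, f * g ∈ I ^ m) :
    f ∈ idealOfVars σ k ^ (m * n / (n + 1)) := by
  set d := m * n / (n + 1) with hd
  have hσ : Nonempty σ := by
    rw [← Fintype.card_pos_iff]
    omega
  have hdn : (n + 1) * d ≤ m * n := Nat.mul_div_le _ _
  have hdm : d ≤ m := by nlinarith
  clear_value d
  obtain ⟨e, rfl⟩ := Nat.exists_eq_add_of_le hdm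
  obtain ⟨a, hae, hadeg⟩ := exists_finsupp_le_degree_eq (σ := σ) e (d + 2 * e)
    (by rw [hn]; nlinarith)
  have hy : (φ.symm (monomial a 1)).IsHomogeneous (d + 2 * e) := by
    rw [← hadeg]
    have := (isHomogeneous_monomial (1 : K) (rfl : a.degree = a.degree)).aeval
      (fun i ↦ φ.symm (X i)) hφ'
    rw [one_mul] at this
    have huniq := congrArg (· (monomial a 1))
      (aeval_unique (φ.symm : MvPolynomial σ K →ₐ[K] MvPolynomial σ K))
    exact huniq ▸ this
  have hy0 : φ.symm (monomial a 1) ≠ 0 := by simp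
  obtain ⟨x, hx⟩ := ne_zero_iff.mp hy0
  obtain ⟨l, hl⟩ : ∃ l : Module.Dual k K, l (coeff x (φ.symm (monomial a 1))) ≠ 0 := by
    by_contra! h
    exact hx ((Module.forall_dual_apply_eq_zero_iff k _).mp h)
  set h := coeffMap σ l (φ.symm (monomial a 1)) with hh
  have hxdeg : x.degree = d + 2 * e := by
    by_contra hne
    exact hx (hy.coeff_eq_zero hne)
  have hmem : h ∈ symbolicPower I (d + e) := by
    refine mem_symbolicPower_of_forall_mul_mem hrad h2 (t := 2 * (d + e)) fun u hu ↦ ?_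
    rw [hh, ← coeffMap_map_mul]
    refine coeffMap_mem_of_mem_map l ((mem_map_pow_iff hI _ _).mpr ?_)
    rw [map_mul, AlgEquiv.apply_symm_apply]
    classical
    refine mem_completeEdgeIdeal_pow_of_support fun c hc ↦ ?_
    obtain ⟨b, hb, a', ha', rfl⟩ := Finset.mem_add.mp (support_mul _ _ hc)
    obtain rfl := Finset.mem_singleton.mp (support_monomial_subset ha')
    have hbd : 2 * (d + e) ≤ b.degree := by
      have h := map_idealOfVars_pow_le (φ := (φ : _ →ₐ[K] _)) hφ _
        (Ideal.mem_map_of_mem _ (map_mem_idealOfVars_pow (algebraMap k K) hu))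
      by_contra! hlt
      exact mem_support_iff.mp hb ((mem_pow_idealOfVars_iff' _ _).mp h b hlt)
    rw [map_add, hadeg]
    refine ⟨by omega, fun i ↦ ?_⟩
    have := hae i
    have := Finsupp.le_degree i b
    rw [Finsupp.add_apply]
    omega
  have hfh : f * h ∈ idealOfVars σ k ^ (2 * (d + e)) := by
    rw [pow_mul]
    exact Ideal.pow_right_mono h2 _ (hf h hmem)
  have h1 : ((2 * (d + e) : ℕ) : ℕ∞) ≤ ((f * h : MvPolynomial σ k) : MvPowerSeries σ k).order := by
    refine MvPowerSeries.nat_le_order fun z hz ↦ ?_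
    rw [coeff_coe]
    exact (mem_pow_idealOfVars_iff' _ _).mp hfh z hz
  have h3 : (h : MvPowerSeries σ k).order ≤ (d + 2 * e : ℕ) := by
    rw [← hxdeg]
    refine MvPowerSeries.order_le ?_
    rwa [coeff_coe, hh, coeff_coeffMap]
  rw [mem_pow_idealOfVars_iff']
  intro z hz
  by_contra hne
  have h4 : (f : MvPowerSeries σ k).order ≤ z.degree :=
    MvPowerSeries.order_le (by rwa [coeff_coe])
  rw [coe_mul, MvPowerSeries.order_mul] at h1
  have h5 := h1.trans (add_le_add h4 h3)
  norm_cast at h5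
  omega

end Main

end MvPolynomial

theorem stmt8 {k : Type u} [Field k] [PerfectField k] (N : ℕ) (hN : 3 ≤ N)
    (I : Ideal (MvPolynomial (Fin N) k))
    (hrad : I.IsRadical)
    (hhom : ∀ f ∈ I, ∀ n, MvPolynomial.homogeneousComponent n f ∈ I)
    (hht : idealHeight I = ((N - 1 : ℕ) : ℕ∞))
    (hgens : ∃ g : Fin (N.choose 2) → MvPolynomial (Fin N) k,
      (∀ i, (g i).IsHomogeneous 2) ∧ Ideal.span (Set.range g) = I)
    (hminimal : ∀ (r : ℕ) (f : Fin r → MvPolynomial (Fin N) k),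
      Ideal.span (Set.range f) = I → N.choose 2 ≤ r)
    (m : ℕ) (hm : 0 < m) :
    Submodule.colon (I ^ m) (symbolicPower I m)
      = (Ideal.span (Set.range (MvPolynomial.X : Fin N → MvPolynomial (Fin N) k)))
          ^ ((m * (N - 2)) / (N - 1)) := by
  obtain ⟨g, hg, rfl⟩ := hgens
  obtain ⟨n, rfl⟩ : ∃ n, N = n + 2 := ⟨N - 2, by omega⟩
  have hspan : (Ideal.span (Set.range g)).map
      (MvPolynomial.map (algebraMap k (AlgebraicClosure k))) =
      Ideal.span (Set.range fun i ↦
        MvPolynomial.map (algebraMap k (AlgebraicClosure k)) (g i)) := by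
    rw [Ideal.map_span, ← Set.range_comp]
    rfl
  have hmap : (Ideal.span (Set.range g)).map
      (MvPolynomial.map (algebraMap k (AlgebraicClosure k))) |>.IsRadical :=
    MvPolynomial.isRadical_map_of_isAlgebraic hrad
  rw [hspan] at hmap
  obtain ⟨φ, hφ, hφ', hE⟩ := MvPolynomial.exists_algEquiv_map_eq_completeEdgeIdeal (by simp)
    (fun i ↦ (hg i).map _)
    (MvPolynomial.linearIndependent_map
      (linearIndependent_of_forall_le_of_span_eq g hminimal)) hmap
  rw [← hspan] at hE
  ext f
  rw [Submodule.mem_colon]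
  constructor
  · exact MvPolynomial.mem_idealOfVars_pow_of_forall_mul_mem hφ hφ' hE hrad
      (MvPolynomial.span_range_le_idealOfVars_pow hg) (Fintype.card_fin _)
  · exact fun hf s hs ↦ MvPolynomial.mul_mem_pow_of_mem_symbolicPower hφ hφ' hE
      (Fintype.card_fin _) hht hf hs
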